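/- arXiv:2510.11540 — 3 statements merged into one kernel-verified Lean document; each statement's English description precedes it below -/
import Mathlib

section
/- Let R be a commutative ring, f1,…,fn a regular sequence in R generating J. Then for every k ≥ 1 the Buchsbaum–Eisenbud complex L^k(f) is a free resolution of R/J^k; equivalently, R/J^k is quasi-isomorphic to Z[x1,…,xn]/(x1,…,xn)^k ⊗^L_{Z[x1,…,xn]} R with x_i ↦ f_i, so Tor_i^{Z[x1,…,xn]}(Z[x1,…,xn]/(x1,…,xn)^k, R) = 0 for all i > 0. -/
open CategoryTheory

universe u

namespace TorVanish

section general
variable {A : Type*} [CommRing A] {P : Type*} [AddCommGroup P] [Module A P]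

lemma proj_colon [Module.Projective A P] (L L' : Ideal A) (t : A)
    (h : ∀ a, t * a ∈ L → a ∈ L') (p : P) (hp : t • p ∈ L • (⊤ : Submodule A P)) :
    p ∈ L' • (⊤ : Submodule A P) := by
  obtain ⟨s, hs⟩ := Module.projective_def'.1 (inferInstance : Module.Projective A P)
  have h1 : ∀ q ∈ L • (⊤ : Submodule A P), ∀ i, s q i ∈ L := by
    intro q hq i
    refine Submodule.smul_induction_on hq ?_ ?_
    · intro r hr n _
      simpa using L.mul_mem_right _ hr
    · intro x y hx hy
      simpa using L.add_mem hx hy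
  have h2 : ∀ i, s p i ∈ L' := fun i => h _ (by simpa using h1 _ hp i)
  have h3 : p = Finsupp.linearCombination A id (s p) := by
    simpa using (LinearMap.congr_fun hs p).symm
  rw [h3, Finsupp.linearCombination_apply]
  refine Submodule.sum_mem _ fun i _ => Submodule.smul_mem_smul (h2 i) trivial

/-- `Tor₁(A/L, P/K) = 0`. -/
def Good (K : Submodule A P) (L : Ideal A) : Prop :=
  ∀ z ∈ K, z ∈ L • (⊤ : Submodule A P) → z ∈ L • K

lemma mem_sup_span_smul {N : Submodule A P} {L : Ideal A} {t : A} {z : P} :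
    z ∈ (L ⊔ Ideal.span {t}) • N ↔ ∃ l ∈ L • N, ∃ y ∈ N, z = l + t • y := by
  rw [Submodule.sup_smul, Submodule.mem_sup]
  constructor
  · rintro ⟨l, hl, w, hw, rfl⟩
    rw [Submodule.ideal_span_singleton_smul] at hw
    obtain ⟨y, hy, rfl⟩ := hw
    exact ⟨l, hl, y, hy, rfl⟩
  · rintro ⟨l, hl, y, hy, rfl⟩
    exact ⟨l, hl, _, Submodule.smul_mem_smul (Ideal.mem_span_singleton_self t) hy, rfl⟩

lemma good_ext [Module.Projective A P] (K : Submodule A P) (L L' : Ideal A) (t : A)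
    (h : ∀ a, t * a ∈ L ↔ a ∈ L') (h1 : Good K L') (h2 : Good K (L ⊔ Ideal.span {t})) :
    Good K L := by
  intro z hz hzL
  obtain ⟨l, hl, y, hy, rfl⟩ := mem_sup_span_smul.1
    (h2 z hz (Submodule.smul_mono_left le_sup_left hzL))
  refine add_mem hl ?_
  have hl' : l ∈ L • (⊤ : Submodule A P) := Submodule.smul_mono le_rfl le_top hl
  have : t • y ∈ L • (⊤ : Submodule A P) := by
    simpa using sub_mem hzL hl'
  have hy' := h1 y hy (proj_colon L L' t (fun a => (h a).1) y this)
  refine Submodule.smul_induction_on hy' ?_ ?_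
  · intro r hr n hn
    rw [smul_smul]
    exact Submodule.smul_mem_smul ((h r).2 hr) hn
  · intro x y hx hy
    rw [smul_add]; exact add_mem hx hy

lemma good_reg (K : Submodule A P) (L : Ideal A) (t : A) (h1 : Good K L)
    (h : ∀ p : P, t • p ∈ K ⊔ L • ⊤ → p ∈ K ⊔ L • (⊤ : Submodule A P)) :
    Good K (L ⊔ Ideal.span {t}) := by
  intro z hz hzL
  obtain ⟨l, hl, p, -, rfl⟩ := mem_sup_span_smul.1 hzL
  have : t • p ∈ K ⊔ L • (⊤ : Submodule A P) :=
    Submodule.mem_sup.2 ⟨l + t • p, hz, -l, neg_mem hl, by abel⟩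
  obtain ⟨y, hy, l', hl', rfl⟩ := Submodule.mem_sup.1 (h p this)
  refine mem_sup_span_smul.2 ⟨l + t • l', ?_, y, hy, by rw [smul_add]; abel⟩
  refine h1 _ ?_ (add_mem hl (Submodule.smul_mem _ _ hl'))
  have := sub_mem hz (K.smul_mem t hy)
  convert this using 1
  rw [smul_add]; abel

end general

section poly
variable {B : Type*} [CommRing B] {n : ℕ}

open MvPolynomial

/-- ideal of the first `j` variables -/
noncomputable def V (B : Type*) [CommRing B] (n j : ℕ) : Ideal (MvPolynomial (Fin n) B) :=
  Ideal.span (X '' {i : Fin n | i.1 < j})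

lemma V_zero : V B n 0 = ⊥ := by simp [V]

lemma V_succ (j : Fin n) : V B n (j + 1) = V B n j ⊔ Ideal.span {X j} := by
  rw [V, V, ← Ideal.span_union, ← Set.image_singleton, ← Set.image_union]
  congr 2
  ext i
  simp [Fin.ext_iff]; omega

lemma V_top : V B n n = Ideal.span (Set.range X) := by
  simp [V, ← Set.image_univ]

lemma V_colon (j : Fin n) (a : MvPolynomial (Fin n) B) : X j * a ∈ V B n j ↔ a ∈ V B n j := by
  refine ⟨fun h => ?_, fun h => Ideal.mul_mem_left _ _ h⟩
  rw [V, mem_ideal_span_X_image] at h ⊢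
  intro m hm
  obtain ⟨i, hi, hi'⟩ := h (Finsupp.single j 1 + m) (by
    rw [mem_support_iff] at hm ⊢
    rwa [coeff_X_mul])
  refine ⟨i, hi, ?_⟩
  have : i ≠ j := by rintro rfl; simp at hi
  simpa [Finsupp.single_apply, this.symm] using hi'

/-- The monomial ideal between `I ^ (k+1)` and `I ^ k`. -/
noncomputable def W (B : Type*) [CommRing B] (n k : ℕ) (S : Finset (Fin n →₀ ℕ)) :
    Ideal (MvPolynomial (Fin n) B) :=
  Ideal.span ((fun s => monomial s (1 : B)) ''
    {m | k + 1 ≤ m.degree ∨ (m.degree = k ∧ m ∉ S)})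

lemma W_sup (k : ℕ) (S : Finset (Fin n →₀ ℕ)) (t : Fin n →₀ ℕ) (ht : t.degree = k)
    (htS : t ∉ S) :
    W B n k (insert t S) ⊔ Ideal.span {monomial t 1} = W B n k S := by
  rw [W, W, ← Ideal.span_union, ← Set.image_singleton (f := fun s => monomial s (1 : B)),
    ← Set.image_union]
  congr 2
  ext i
  by_cases h : i = t
  · subst h; simp [ht, htS]
  · simp [h]

lemma W_colon (k : ℕ) (S : Finset (Fin n →₀ ℕ)) (t : Fin n →₀ ℕ) (ht : t.degree = k)
    (a : MvPolynomial (Fin n) B) :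
    monomial t 1 * a ∈ W B n k (insert t S) ↔ a ∈ idealOfVars (Fin n) B := by
  rw [← pow_one (idealOfVars (Fin n) B), mem_pow_idealOfVars_iff, W, mem_ideal_span_monomial_image]
  constructor
  · intro h m hm
    obtain ⟨s, hs, hs'⟩ := h (t + m) (by
      rw [mem_support_iff] at hm ⊢
      rwa [coeff_monomial_mul, one_mul])
    by_contra hc
    have hm0 : m.degree = 0 := by omega
    rw [Finsupp.degree_eq_zero_iff] at hm0
    subst hm0
    rw [add_zero] at hs'
    have hd := Finsupp.degree_mono hs'
    obtain ⟨c, rfl⟩ := exists_add_of_le hs'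
    rw [map_add] at ht hd
    rcases hs with hs | ⟨hs, hs2⟩
    · omega
    · have : c.degree = 0 := by omega
      rw [Finsupp.degree_eq_zero_iff] at this
      subst this
      simp at hs2
  · intro h m hm
    classical
    rw [mem_support_iff, coeff_monomial_mul'] at hm
    split_ifs at hm with htm
    · refine ⟨m, Or.inl ?_, le_rfl⟩
      have := h (m - t) (by rw [mem_support_iff]; simpa using hm)
      have h2 : m.degree = (m - t).degree + t.degree := by
        rw [← map_add, tsub_add_cancel_of_le htm]
      omega
    · exact absurd rfl hm

lemma W_empty (k : ℕ) : W B n k ∅ = idealOfVars (Fin n) B ^ k := by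
  ext p
  rw [mem_pow_idealOfVars_iff, W, mem_ideal_span_monomial_image]
  refine forall₂_congr fun m _ => ⟨?_, fun h => ⟨m, ?_, le_rfl⟩⟩
  · rintro ⟨s, hs, hs'⟩
    have := Finsupp.degree_mono hs'
    simp at hs
    omega
  · simp; omega

lemma W_full (k : ℕ) (S : Finset (Fin n →₀ ℕ)) (hS : ∀ m, m.degree = k → m ∈ S) :
    W B n k S = idealOfVars (Fin n) B ^ (k + 1) := by
  ext p
  rw [mem_pow_idealOfVars_iff, W, mem_ideal_span_monomial_image]
  refine forall₂_congr fun m _ => ⟨?_, fun h => ⟨m, Or.inl h, le_rfl⟩⟩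
  rintro ⟨s, hs | hs, hs'⟩
  · exact hs.trans (Finsupp.degree_mono hs')
  · exact absurd (hS _ hs.1) hs.2

variable {P : Type*} [AddCommGroup P] [Module (MvPolynomial (Fin n) B) P]
  {M : Type*} [AddCommGroup M] [Module (MvPolynomial (Fin n) B) M]

lemma good_pow [Module.Projective (MvPolynomial (Fin n) B) P]
    (K : Submodule (MvPolynomial (Fin n) B) P) (h : Good K (idealOfVars (Fin n) B)) (k : ℕ) :
    Good K (idealOfVars (Fin n) B ^ k) := by
  induction k with
  | zero => intro z hz _; simpa using hz
  | succ k ih =>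
    have key : ∀ S : Finset (Fin n →₀ ℕ), Good K (W B n k S) := by
      intro S
      induction S using Finset.induction_on with
      | empty => rwa [W_empty]
      | insert t S htS ih2 =>
        by_cases ht : t.degree = k
        · refine good_ext K _ _ (monomial t 1) (W_colon k S t ht) h ?_
          rwa [W_sup k S t ht htS]
        · have : W B n k (insert t S) = W B n k S := by
            rw [W, W]; congr 2; ext m
            by_cases h : m = t
            · subst h; simp [ht]
            · simp [h]
          rwa [this]
    have hfin : {m : Fin n →₀ ℕ | m.degree = k}.Finite :=
      (Finsupp.finite_of_degree_le k).subset fun m hm => le_of_eq hm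
    rw [← W_full k hfin.toFinset (by simp)]
    exact key _

/-- the variables form a weakly regular sequence on the submodule `N` -/
def Reg (N : Submodule (MvPolynomial (Fin n) B) M) : Prop :=
  ∀ j : Fin n, ∀ y ∈ N, (X j : MvPolynomial (Fin n) B) • y ∈ V B n j • N → y ∈ V B n j • N

lemma main [Module.Projective (MvPolynomial (Fin n) B) P]
    (φ : P →ₗ[MvPolynomial (Fin n) B] M) (h : Reg (LinearMap.range φ)) :
    Reg (LinearMap.ker φ) ∧ ∀ k, Good (LinearMap.ker φ) (idealOfVars (Fin n) B ^ k) := by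
  have hmem : ∀ (L : Ideal (MvPolynomial (Fin n) B)) (p : P),
      p ∈ LinearMap.ker φ ⊔ L • ⊤ ↔ φ p ∈ L • LinearMap.range φ := by
    intro L p
    rw [LinearMap.range_eq_map, ← Submodule.map_smul'', ← Submodule.mem_comap,
      Submodule.comap_map_eq, sup_comm]
  have hV : ∀ j ≤ n, Good (LinearMap.ker φ) (V B n j) := by
    intro j
    induction j with
    | zero => intro _ z _ hz; rw [V_zero] at *; simpa using hz
    | succ j ih =>
      intro hj
      rw [V_succ ⟨j, hj⟩]
      refine good_reg _ _ _ (ih (by omega)) fun p hp => ?_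
      rw [hmem] at hp ⊢
      exact h ⟨j, hj⟩ _ ⟨p, rfl⟩ (by simpa using hp)
  refine ⟨fun j y hy hxy => hV j j.2.le y hy ?_, good_pow _ ?_⟩
  · exact proj_colon _ _ (X j) (fun a => (V_colon j a).1) y (Submodule.smul_mono le_rfl le_top hxy)
  · have := hV n le_rfl
    rwa [V_top] at this

lemma reg_top {R : Type*} [CommRing R] (f : Fin n → R)
    (hreg : RingTheory.Sequence.IsWeaklyRegular R (List.ofFn f))
    [Algebra (MvPolynomial (Fin n) B) R]
    (halg : ∀ i : Fin n, algebraMap (MvPolynomial (Fin n) B) R (X i) = f i) :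
    Reg (B := B) (⊤ : Submodule (MvPolynomial (Fin n) B) R) := by
  intro j y _ hy
  have hmem : ∀ z : R, z ∈ V B n j • (⊤ : Submodule (MvPolynomial (Fin n) B) R) ↔
      z ∈ (Ideal.ofList ((List.ofFn f).take j) • ⊤ : Submodule R R) := by
    have : Ideal.ofList ((List.ofFn f).take j) = (V B n j).map (algebraMap _ R) := by
      rw [V, Ideal.map_span, Ideal.ofList]
      congr 1
      ext r
      simp only [Set.mem_ofPred_eq, List.mem_take_iff_getElem, Set.mem_image,
        exists_exists_and_eq_and, halg]
      constructor
      · rintro ⟨i, hi, rfl⟩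
        simp at hi
        exact ⟨⟨i, lt_trans hi j.2⟩, hi, by simp⟩
      · rintro ⟨i, hi, rfl⟩
        exact ⟨i, by simpa using hi, by simp⟩
    intro z
    rw [this, Ideal.smul_top_eq_map]
    simp
  rw [hmem] at hy ⊢
  have := hreg.regular_mod_prev j (by simp)
  have h2 := @this (Submodule.Quotient.mk y) 0 (by
    simp only [smul_zero]
    rw [← Submodule.Quotient.mk_smul, Submodule.Quotient.mk_eq_zero]
    simpa [Algebra.smul_def, halg] using hy)
  rwa [Submodule.Quotient.mk_eq_zero] at h2

end poly

section tensor
variable {A : Type*} [CommRing A] {P Q S : Type*} [AddCommGroup P] [Module A P]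
  [AddCommGroup Q] [Module A Q] [AddCommGroup S] [Module A S]

lemma one_tmul_eq_zero (L : Ideal A) (p : P) :
    ((1 : A ⧸ L) ⊗ₜ[A] p = 0) ↔ p ∈ L • (⊤ : Submodule A P) := by
  rw [← (TensorProduct.quotTensorEquivQuotSMul P L).map_eq_zero_iff,
    show (1 : A ⧸ L) = Ideal.Quotient.mk L 1 from rfl,
    TensorProduct.quotTensorEquivQuotSMul_mk_tmul, one_smul, Submodule.Quotient.mk_eq_zero]

lemma exists_one_tmul (L : Ideal A) (z : TensorProduct A (A ⧸ L) P) :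
    ∃ p : P, z = (1 : A ⧸ L) ⊗ₜ[A] p := by
  induction z using TensorProduct.induction_on with
  | zero => exact ⟨0, by simp⟩
  | tmul a p =>
    obtain ⟨a, rfl⟩ := Ideal.Quotient.mk_surjective a
    refine ⟨a • p, ?_⟩
    rw [← TensorProduct.smul_tmul, Algebra.smul_def, mul_one]; rfl
  | add x y hx hy =>
    obtain ⟨p, rfl⟩ := hx
    obtain ⟨q, rfl⟩ := hy
    exact ⟨p + q, by rw [TensorProduct.tmul_add]⟩

lemma tensor_exact (L : Ideal A) (g : P →ₗ[A] Q) (f : Q →ₗ[A] S)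
    (hgf : LinearMap.range g = LinearMap.ker f)
    (hL : Good (LinearMap.range f) L) (z : TensorProduct A (A ⧸ L) Q)
    (hz : f.lTensor (A ⧸ L) z = 0) : ∃ w, g.lTensor (A ⧸ L) w = z := by
  obtain ⟨q, rfl⟩ := exists_one_tmul L z
  rw [LinearMap.lTensor_tmul, one_tmul_eq_zero] at hz
  have h1 := hL _ ⟨q, rfl⟩ hz
  rw [LinearMap.range_eq_map, ← Submodule.map_smul''] at h1
  obtain ⟨q', hq', h2⟩ := h1
  have : q - q' ∈ LinearMap.range g := by rw [hgf]; simp [h2]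
  obtain ⟨p, hp⟩ := this
  refine ⟨(1 : A ⧸ L) ⊗ₜ[A] p, ?_⟩
  rw [LinearMap.lTensor_tmul, hp, TensorProduct.tmul_sub, (one_tmul_eq_zero L q').2 hq', sub_zero]

end tensor

end TorVanish

open TorVanish

/-- If `f 1, …, f n` is a regular sequence in `R`, viewing `R` as an algebra over
`A = ℤ[x 1, …, x n]` via `x i ↦ f i`, the Buchsbaum–Eisenbud complex `L^k(f)` is a free
resolution of `R ⧸ J ^ k`; equivalently,
`Tor_i^A (A ⧸ (x 1, …, x n) ^ k, R) = 0` for all `i > 0`. -/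
theorem stmt4 {R : Type u} [CommRing R] {n : ℕ} (f : Fin n → R)
    (hreg : RingTheory.Sequence.IsRegular R (List.ofFn f))
    [Algebra (MvPolynomial (Fin n) (ULift.{u} ℤ)) R]
    (halg : ∀ i : Fin n,
      algebraMap (MvPolynomial (Fin n) (ULift.{u} ℤ)) R (MvPolynomial.X i) = f i)
    (k : ℕ) (hk : 1 ≤ k) (i : ℕ) (hi : 0 < i) :
    Limits.IsZero
      (((Tor (ModuleCat.{u} (MvPolynomial (Fin n) (ULift.{u} ℤ))) i).obj
          (ModuleCat.of (MvPolynomial (Fin n) (ULift.{u} ℤ))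
            ((MvPolynomial (Fin n) (ULift.{u} ℤ)) ⧸
              (Ideal.span (Set.range
                (MvPolynomial.X : Fin n → MvPolynomial (Fin n) (ULift.{u} ℤ)))) ^ k))).obj
        (ModuleCat.of (MvPolynomial (Fin n) (ULift.{u} ℤ)) R)) := by
  obtain ⟨i, rfl⟩ : ∃ j, i = j + 1 := ⟨i - 1, by omega⟩
  let Q := projectiveResolution (ModuleCat.of (MvPolynomial (Fin n) (ULift.{u} ℤ)) R)
  have hproj : ∀ j, Module.Projective (MvPolynomial (Fin n) (ULift.{u} ℤ)) (Q.complex.X j) :=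
    fun j => (IsProjective.iff_projective _).2 (Q.projective j)
  have hex : ∀ j, LinearMap.range (Q.complex.d (j + 2) (j + 1)).hom =
      LinearMap.ker (Q.complex.d (j + 1) j).hom := fun j =>
    (ShortComplex.moduleCat_exact_iff_range_eq_ker _).1 (Q.exact_succ j)
  have hex0 : LinearMap.range (Q.complex.d 1 0).hom = LinearMap.ker (Q.π.f 0).hom :=
    (ShortComplex.moduleCat_exact_iff_range_eq_ker _).1 Q.exact₀
  have hsurj : LinearMap.range (Q.π.f 0).hom = ⊤ :=
    LinearMap.range_eq_top.2 ((ModuleCat.epi_iff_surjective _).1 inferInstance)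
  have h0 : Reg (LinearMap.range (Q.π.f 0).hom) := by
    rw [hsurj]
    exact reg_top f hreg.toIsWeaklyRegular halg
  have hall : ∀ j, Reg (LinearMap.range (Q.complex.d (j + 1) j).hom) ∧
      Good (LinearMap.range (Q.complex.d (j + 1) j).hom)
        (MvPolynomial.idealOfVars (Fin n) (ULift.{u} ℤ) ^ k) := by
    intro j
    induction j with
    | zero =>
      rw [hex0]
      exact ⟨(main _ h0).1, (main _ h0).2 k⟩
    | succ j ih =>
      rw [hex]
      exact ⟨(main _ ih.1).1, (main _ ih.1).2 k⟩
  refine Limits.IsZero.of_iso ?_ (Q.isoLeftDerivedObj _ (i + 1))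
  refine (HomologicalComplex.exactAt_iff_isZero_homology _ _).1 ?_
  rw [HomologicalComplex.exactAt_iff' _ (i + 2) (i + 1) i (by simp) (by simp),
    ShortComplex.moduleCat_exact_iff]
  intro z hz
  exact tensor_exact _ (Q.complex.d (i + 2) (i + 1)).hom (Q.complex.d (i + 1) i).hom (hex i)
    (hall i).2 z hz
end

section
/- Let R be a Noetherian ring and let M → N be a morphism in the derived category D(R) whose cone C lies in D^-_{coh}(R), with M ∈ D^+(R). Then M → N is pure (i.e., for every perfect complex P and map P → C, the composition P → M[1] is zero) if and only if M → N admits a left inverse in D(R). -/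
open CategoryTheory Limits Pretriangulated

universe w u

noncomputable section

/-- An object of the derived category `D(R)` is perfect if it is isomorphic to a bounded
complex of finitely generated projective modules. -/
def IsPerfectObj {R : Type u} [CommRing R] [HasDerivedCategory.{w} (ModuleCat.{u} R)]
    (P : DerivedCategory (ModuleCat.{u} R)) : Prop :=
  ∃ K : CochainComplex (ModuleCat.{u} R) ℤ,
    (∀ i : ℤ, Module.Finite R (K.X i) ∧ Projective (K.X i)) ∧
    (∃ a b : ℤ, ∀ i : ℤ, (i < a ∨ b < i) → IsZero (K.X i)) ∧
    Nonempty (P ≅ DerivedCategory.Q.obj K)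

/-- A map `M ⟶ N` in `D(R)` is pure if for any distinguished triangle
`M ⟶ N ⟶ C ⟶ M[1]`, every composition `P ⟶ C ⟶ M[1]` with `P` perfect is zero. -/
def IsPureMap {R : Type u} [CommRing R] [HasDerivedCategory.{w} (ModuleCat.{u} R)]
    {M N : DerivedCategory (ModuleCat.{u} R)} (φ : M ⟶ N) : Prop :=
  ∀ (C : DerivedCategory (ModuleCat.{u} R)) (g : N ⟶ C) (δ : C ⟶ M⟦(1 : ℤ)⟧),
    ((Triangle.mk φ g δ) ∈ distTriang (DerivedCategory (ModuleCat.{u} R))) →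
    ∀ P : DerivedCategory (ModuleCat.{u} R), IsPerfectObj P → ∀ p : P ⟶ C, p ≫ δ = 0

section Helpers

lemma fin_of_exact {R : Type u} [CommRing R] [IsNoetherianRing R] (S : ShortComplex (ModuleCat.{u} R)) (hS : S.Exact)
    (h1 : Module.Finite R S.X₁) (h3 : Module.Finite R S.X₃) : Module.Finite R S.X₂ := by
  have h := hS.moduleCat_range_eq_ker
  have := isNoetherian_of_range_eq_ker S.f.hom S.g.hom h
  infer_instance

lemma exists_single_epi {R : Type u} [CommRing R] (K : CochainComplex (ModuleCat.{u} R) ℤ) (n : ℤ)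
    (h : Module.Finite R (K.homology n)) :
    ∃ (F : ModuleCat.{u} R) (_ : Module.Finite R F) (_ : Projective F)
      (f : (HomologicalComplex.single _ (ComplexShape.up ℤ) n).obj F ⟶ K),
      Epi (HomologicalComplex.homologyMap f n) := by
  obtain ⟨k, q, hq⟩ := Module.Finite.exists_fin' R (K.homology n)
  let F : ModuleCat.{u} R := ModuleCat.of R (ULift.{u} (Fin k) → R)
  let q' : F ⟶ K.homology n := ModuleCat.ofHom
    (q ∘ₗ (LinearEquiv.funCongrLeft R R (Equiv.ulift.{u} (α := Fin k)).symm).toLinearMap)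
  have hq' : Epi q' := by
    rw [ModuleCat.epi_iff_surjective]
    exact hq.comp (LinearEquiv.surjective _)
  have : Projective F := ModuleCat.projective_of_free (Pi.basisFun R (ULift.{u} (Fin k)))
  let l : F ⟶ K.cycles n := Projective.factorThru q' (K.homologyπ n)
  have hl : l ≫ K.homologyπ n = q' := Projective.factorThru_comp _ _
  let f := HomologicalComplex.mkHomFromSingle (K := K) (l ≫ K.iCycles n) (fun j _ => by simp)
  refine ⟨F, inferInstanceAs (Module.Finite R (ULift.{u} (Fin k) → R)), this, f, ?_⟩
  have hc : HomologicalComplex.cyclesMap f n =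
      (HomologicalComplex.singleObjCyclesSelfIso (ComplexShape.up ℤ) n F).hom ≫ l := by
    rw [← cancel_mono (K.iCycles n), HomologicalComplex.cyclesMap_i,
      HomologicalComplex.singleObjCyclesSelfIso_hom,
      HomologicalComplex.mkHomFromSingle_f]
    simp
  have h2 : HomologicalComplex.homologyπ _ n ≫ HomologicalComplex.homologyMap f n =
      (HomologicalComplex.singleObjCyclesSelfIso (ComplexShape.up ℤ) n F).hom ≫ q' := by
    rw [HomologicalComplex.homologyπ_naturality, hc, Category.assoc, hl]
  have : Epi (HomologicalComplex.homologyπ _ n ≫ HomologicalComplex.homologyMap f n) := by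
    rw [h2]; infer_instance
  exact epi_of_epi (HomologicalComplex.homologyπ _ n) _

variable {R : Type u} [CommRing R] [HasDerivedCategory.{w} (ModuleCat.{u} R)]

lemma perf_of_iso {P P' : DerivedCategory (ModuleCat.{u} R)} (e : P ≅ P') (h : IsPerfectObj P) :
    IsPerfectObj P' := by
  obtain ⟨K, h1, h2, ⟨e'⟩⟩ := h
  exact ⟨K, h1, h2, ⟨e.symm ≪≫ e'⟩⟩

lemma perf_shift {P : DerivedCategory (ModuleCat.{u} R)} (h : IsPerfectObj P) (n : ℤ) :
    IsPerfectObj (P⟦n⟧) := by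
  obtain ⟨K, h1, ⟨a, b, h2⟩, ⟨e'⟩⟩ := h
  refine ⟨K⟦n⟧, fun i => h1 (i + n), ⟨a - n, b - n, fun i hi => h2 (i + n) (by omega)⟩, ⟨?_⟩⟩
  exact (shiftFunctor _ n).mapIso e' ≪≫ ((DerivedCategory.Q.commShiftIso n).app K).symm

open scoped ZeroObject in
lemma perf_of_isZero {P : DerivedCategory (ModuleCat.{u} R)} (h : IsZero P) :
    IsPerfectObj P := by
  have hz : ∀ i : ℤ, IsZero ((0 : CochainComplex (ModuleCat.{u} R) ℤ).X i) := fun i =>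
    (HomologicalComplex.eval _ _ i).map_isZero (isZero_zero _)
  refine ⟨0, fun i => ⟨?_, (hz i).projective⟩, ⟨0, 0, fun i _ => hz i⟩,
    ⟨h.iso (DerivedCategory.Q.map_isZero (isZero_zero _))⟩⟩
  have := ModuleCat.subsingleton_of_isZero (hz i)
  infer_instance

lemma perf_single (F : ModuleCat.{u} R) [Module.Finite R F] [Projective F] (n : ℤ) :
    IsPerfectObj (DerivedCategory.Q.obj ((HomologicalComplex.single _ (ComplexShape.up ℤ) n).obj F)) := by
  refine ⟨_, fun i => ?_, ⟨n, n, fun i hi => ?_⟩, ⟨Iso.refl _⟩⟩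
  · by_cases hi : i = n
    · let e := HomologicalComplex.singleObjXIsoOfEq (ComplexShape.up ℤ) n F i hi
      exact ⟨Module.Finite.equiv e.toLinearEquiv.symm, Projective.of_iso e.symm inferInstance⟩
    · have hz := HomologicalComplex.isZero_single_obj_X (ComplexShape.up ℤ) n F i hi
      have := ModuleCat.subsingleton_of_isZero hz
      exact ⟨inferInstance, hz.projective⟩
  · exact HomologicalComplex.isZero_single_obj_X (ComplexShape.up ℤ) n F i (by omega)

lemma perf_cone {A P P' : DerivedCategory (ModuleCat.{u} R)} (hA : IsPerfectObj A)
    (hP : IsPerfectObj P) (f : A ⟶ P) (g : P ⟶ P') (d : P' ⟶ A⟦(1 : ℤ)⟧)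
    (hT : Triangle.mk f g d ∈ distTriang _) : IsPerfectObj P' := by
  obtain ⟨K, hK1, ⟨a, b, hK2⟩, ⟨eK⟩⟩ := hA
  obtain ⟨L, hL1, ⟨a', b', hL2⟩, ⟨eL⟩⟩ := hP
  have : K.IsStrictlyLE b := by
    rw [CochainComplex.isStrictlyLE_iff]
    exact fun i hi => hK2 i (Or.inr hi)
  have : ∀ i, Projective (K.X i) := fun i => (hK1 i).2
  have : K.IsKProjective := CochainComplex.isKProjective_of_projective K b
  obtain ⟨t, ht⟩ := (CochainComplex.IsKProjective.Qh_map_bijective K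
    ((HomotopyCategory.quotient _ _).obj L)).surjective
    ((DerivedCategory.quotientCompQhIso _).hom.app K ≫ eK.inv ≫ f ≫ eL.hom ≫
      (DerivedCategory.quotientCompQhIso _).inv.app L)
  obtain ⟨t, rfl⟩ := (HomotopyCategory.quotient _ _).map_surjective t
  have ht' : DerivedCategory.Q.map t = eK.inv ≫ f ≫ eL.hom := by
    rw [← cancel_epi ((DerivedCategory.quotientCompQhIso _).hom.app K),
      ← DerivedCategory.quotientCompQhIso_hom_naturality, ht]
    simp
  have e := isoTriangleOfIso₁₂ _ _ hT
    (DerivedCategory.mappingCone_triangle_distinguished t) eK eL (by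
      change f ≫ eL.hom = eK.hom ≫ DerivedCategory.Q.map t
      rw [ht']; simp)
  have hX : ∀ i : ℤ, Nonempty ((CochainComplex.mappingCone t).X i ≅ K.X (i + 1) ⊞ L.X i) :=
    fun i => ⟨HomologicalComplex.homotopyCofiber.XIsoBiprod t i (i + 1) rfl⟩
  refine ⟨CochainComplex.mappingCone t, fun i => ?_,
    ⟨min (a - 1) a', max b b', fun i hi => ?_⟩, ⟨Triangle.π₃.mapIso e⟩⟩
  · obtain ⟨e⟩ := hX i
    have := (hK1 (i + 1)).1
    have := (hL1 i).1
    have := (hL1 i).2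
    refine ⟨?_, Projective.of_iso e.symm inferInstance⟩
    exact Module.Finite.equiv (e ≪≫ ModuleCat.biprodIsoProd _ _).toLinearEquiv.symm
  · obtain ⟨e⟩ := hX i
    refine IsZero.of_iso ?_ e
    rw [biprod_isZero_iff]
    exact ⟨hK2 _ (by omega), hL2 _ (by omega)⟩

/-- One killing step. -/
lemma kill_step [IsNoetherianRing R] (C : DerivedCategory (ModuleCat.{u} R)) (n : ℤ)
    (h1 : ∀ i : ℤ, n < i → IsZero ((DerivedCategory.homologyFunctor (ModuleCat.{u} R) i).obj C))
    (h2 : ∀ i : ℤ, Module.Finite R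
        ((DerivedCategory.homologyFunctor (ModuleCat.{u} R) i).obj C)) :
    ∃ (F C' : DerivedCategory (ModuleCat.{u} R)) (f : F ⟶ C) (g : C ⟶ C') (d : C' ⟶ F⟦(1 : ℤ)⟧),
      Triangle.mk f g d ∈ distTriang _ ∧ IsPerfectObj F ∧
      (∀ i : ℤ, n - 1 < i →
        IsZero ((DerivedCategory.homologyFunctor (ModuleCat.{u} R) i).obj C')) ∧
      (∀ i : ℤ, Module.Finite R
        ((DerivedCategory.homologyFunctor (ModuleCat.{u} R) i).obj C')) := by
  obtain ⟨K, ⟨e⟩⟩ : ∃ K, Nonempty (DerivedCategory.Q.obj K ≅ C) :=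
    ⟨_, ⟨DerivedCategory.Q.objObjPreimageIso C⟩⟩
  have hfin : Module.Finite R (K.homology n) := by
    have := h2 n
    exact Module.Finite.equiv ((DerivedCategory.homologyFunctor _ n).mapIso e.symm ≪≫
      (DerivedCategory.homologyFunctorFactors _ n).app K).toLinearEquiv
  obtain ⟨F, hF, hF', f, hf⟩ := exists_single_epi K n hfin
  obtain ⟨C', g, d, hT⟩ := distinguished_cocone_triangle (DerivedCategory.Q.map f ≫ e.hom)
  have hepi : Epi ((DerivedCategory.homologyFunctor _ n).map (DerivedCategory.Q.map f ≫ e.hom)) := by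
    have h3 := DerivedCategory.homologyFunctorFactors_hom_naturality f n
    have h4 : Epi ((DerivedCategory.homologyFunctor _ n).map (DerivedCategory.Q.map f) ≫
        (DerivedCategory.homologyFunctorFactors _ n).hom.app K) := by
      rw [h3]
      exact epi_comp' inferInstance hf
    have h5 := epi_comp' h4 (inferInstance :
      Epi ((DerivedCategory.homologyFunctorFactors _ n).inv.app K))
    rw [Category.assoc, Iso.hom_inv_id_app] at h5
    erw [Category.comp_id] at h5
    rw [Functor.map_comp]
    exact epi_comp' h5 inferInstance
  have eF : ∀ i, (DerivedCategory.homologyFunctor _ i).obj (DerivedCategory.Q.obj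
      ((HomologicalComplex.single _ (ComplexShape.up ℤ) n).obj F)) ≅
      ((HomologicalComplex.single _ (ComplexShape.up ℤ) n).obj F).homology i :=
    fun i => (DerivedCategory.homologyFunctorFactors _ i).app _
  have hFz : ∀ i, i ≠ n → IsZero ((DerivedCategory.homologyFunctor _ i).obj (DerivedCategory.Q.obj
      ((HomologicalComplex.single _ (ComplexShape.up ℤ) n).obj F))) := fun i hi =>
    (HomologicalComplex.isZero_single_obj_homology (ComplexShape.up ℤ) n F i hi).of_iso (eF i)
  have hFf : ∀ i, Module.Finite R ((DerivedCategory.homologyFunctor (ModuleCat.{u} R) i).obj (DerivedCategory.Q.obj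
      ((HomologicalComplex.single _ (ComplexShape.up ℤ) n).obj F))) := fun i => by
    by_cases hi : i = n
    · subst hi
      exact Module.Finite.equiv (eF i ≪≫
        HomologicalComplex.singleObjHomologySelfIso (ComplexShape.up ℤ) i F).toLinearEquiv.symm
    · have := ModuleCat.subsingleton_of_isZero (hFz i hi)
      infer_instance
  refine ⟨_, C', _, g, d, hT, perf_single F n, fun i hi => ?_, fun i => ?_⟩
  · have hex := DerivedCategory.HomologySequence.exact₃ _ hT i (i + 1)
    apply hex.isZero_of_both_zeros
    · by_cases hi' : i = n
      · subst hi'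
        exact (DerivedCategory.HomologySequence.epi_homologyMap_mor₁_iff _ hT i).1 hepi
      · exact (h1 i (by omega)).eq_of_src _ _
    · exact (hFz (i + 1) (by omega)).eq_of_tgt _ _
  · exact fin_of_exact _ (DerivedCategory.HomologySequence.exact₃ _ hT i (i + 1)) (h2 i)
      (hFf (i + 1))

open scoped ZeroObject in
lemma approx [IsNoetherianRing R] (C : DerivedCategory (ModuleCat.{u} R)) (b : ℤ)
    (h1 : ∀ i : ℤ, b < i → IsZero ((DerivedCategory.homologyFunctor (ModuleCat.{u} R) i).obj C))
    (h2 : ∀ i : ℤ, Module.Finite R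
        ((DerivedCategory.homologyFunctor (ModuleCat.{u} R) i).obj C)) (k : ℕ) :
    ∃ (P C' : DerivedCategory (ModuleCat.{u} R)) (f : P ⟶ C) (g : C ⟶ C') (d : C' ⟶ P⟦(1 : ℤ)⟧),
      Triangle.mk f g d ∈ distTriang _ ∧ IsPerfectObj P ∧
      (∀ i : ℤ, b - k < i →
        IsZero ((DerivedCategory.homologyFunctor (ModuleCat.{u} R) i).obj C')) ∧
      (∀ i : ℤ, Module.Finite R
        ((DerivedCategory.homologyFunctor (ModuleCat.{u} R) i).obj C')) := by
  induction k with
  | zero =>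
    exact ⟨0, C, 0, 𝟙 C, 0, contractible_distinguished₁ C, perf_of_isZero (isZero_zero _),
      fun i hi => h1 i (by simpa using hi), h2⟩
  | succ k ih =>
    obtain ⟨P, C', f, g, d, hT, hP, h3, h4⟩ := ih
    obtain ⟨F, C'', f', g', d', hT', hF, h5, h6⟩ := kill_step C' _ h3 h4
    obtain ⟨P', f'', d'', hT''⟩ := distinguished_cocone_triangle₁ (g ≫ g')
    have o := Triangulated.someOctahedron' rfl hT hT' hT''
    refine ⟨P', C'', f'', g ≫ g', d'', hT'', ?_, fun i hi => h5 i (by push_cast at hi; omega), h6⟩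
    exact perf_cone (perf_shift hF (-1)) hP _ _ _ (inv_rot_of_distTriang _ o.mem)

end Helpers

/-- For `R` Noetherian, a map `M ⟶ N` in `D(R)` with `M ∈ D^+(R)` whose cone lies in
`D^-_{coh}(R)` is pure if and only if it admits a left inverse in `D(R)`. -/
theorem stmt5 {R : Type u} [CommRing R] [IsNoetherianRing R]
    [HasDerivedCategory.{w} (ModuleCat.{u} R)]
    {M N : DerivedCategory (ModuleCat.{u} R)} (φ : M ⟶ N)
    -- `M ∈ D^+(R)`: bounded below cohomology
    (hM : ∃ a : ℤ, ∀ i : ℤ, i < a →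
      IsZero ((DerivedCategory.homologyFunctor (ModuleCat.{u} R) i).obj M))
    -- the cone `C` lies in `D^-_{coh}(R)`
    (hC : ∃ (C : DerivedCategory (ModuleCat.{u} R)) (g : N ⟶ C) (δ : C ⟶ M⟦(1 : ℤ)⟧),
      ((Triangle.mk φ g δ) ∈ distTriang (DerivedCategory (ModuleCat.{u} R))) ∧
      (∃ b : ℤ, ∀ i : ℤ, b < i →
        IsZero ((DerivedCategory.homologyFunctor (ModuleCat.{u} R) i).obj C)) ∧
      (∀ i : ℤ, Module.Finite R
        ((DerivedCategory.homologyFunctor (ModuleCat.{u} R) i).obj C))) :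
    IsPureMap φ ↔ ∃ ψ : N ⟶ M, φ ≫ ψ = 𝟙 M := by
  obtain ⟨C, g, δ, hT, ⟨b, hb⟩, hfin⟩ := hC
  obtain ⟨a, ha⟩ := hM
  constructor
  · intro h
    have hδ : δ = 0 := by
      obtain ⟨P, C', f, g', d, hT', hP, h3, -⟩ := approx C b hb hfin (b - a + 2).toNat
      have h0 := h C g δ hT P hP f
      obtain ⟨s, hs⟩ := Triangle.yoneda_exact₂ _ hT' δ h0
      have hMge : M.IsGE a := (DerivedCategory.isGE_iff _ _).2 ha
      have : (M⟦(1 : ℤ)⟧).IsGE (a - 1) :=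
        DerivedCategory.TStructure.t.isGE_shift M a 1 (a - 1)
      have : C'.IsLE (a - 2) := (DerivedCategory.isLE_iff _ _).2 fun i hi => h3 i (by omega)
      rw [hs, DerivedCategory.TStructure.t.zero_of_isLE_of_isGE s (a - 2) (a - 1) (by omega)
        this inferInstance, comp_zero]
      rfl
    have hmono : Mono φ := Triangle.mono₁ _ hT hδ
    have := isSplitMono_of_mono φ
    exact ⟨retraction φ, IsSplitMono.id φ⟩
  · rintro ⟨ψ, hψ⟩ C' g' δ' hT' P - p
    have h0 : δ' ≫ φ⟦(1 : ℤ)⟧' = 0 := comp_distTriang_mor_zero₃₁ _ hT'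
    have : δ' = 0 := by
      calc δ' = δ' ≫ (φ ≫ ψ)⟦(1 : ℤ)⟧' := by rw [hψ]; simp
        _ = 0 := by rw [Functor.map_comp, reassoc_of% h0, zero_comp]
    rw [this, comp_zero]
end
end

section
/- Let (R,m) be a Noetherian local ring of dimension d with infinite residue field and embedding dimension e, and suppose m^{d+1} ⊆ J for some minimal reduction J = (x1,…,xd) of m. Then the Hilbert–Samuel multiplicity satisfies e(R) ≤ binom(e, d). -/
open IsLocalRing Filter

/-- The length of a module, as the Krull dimension of its lattice of submodules. -/
noncomputable def moduleLength (R M : Type*) [CommRing R] [AddCommGroup M] [Module R M] :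
    WithBot ℕ∞ :=
  Order.krullDim (Submodule R M)

lemma length_quot_mono {R : Type*} [CommRing R] {A B : Ideal R} (h : A ≤ B) :
    Module.length R (R ⧸ B) ≤ Module.length R (R ⧸ A) :=
  Module.length_le_of_surjective (Submodule.factor h) (Submodule.factor_surjective h)

lemma length_quot_step {R : Type*} [CommRing R] {A B : Ideal R} (y : R)
    (h : ∀ a ∈ A, y * a ∈ B) :
    Module.length R (R ⧸ B) ≤
      Module.length R (R ⧸ A) + Module.length R (R ⧸ (B ⊔ Ideal.span {y})) := by
  have hle : B ≤ B ⊔ Ideal.span {y} := le_sup_left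
  let g : (R ⧸ B) →ₗ[R] (R ⧸ (B ⊔ Ideal.span {y})) := Submodule.factor hle
  have hg : Function.Surjective g := Submodule.factor_surjective hle
  rw [Module.length_eq_add_of_exact (LinearMap.ker g).subtype g
    (Submodule.subtype_injective _) hg (LinearMap.exact_subtype_ker_map g)]
  gcongr
  let f : (R ⧸ A) →ₗ[R] (R ⧸ B) :=
    Submodule.mapQ A B (LinearMap.mulLeft R y) (fun a ha => h a ha)
  have hf : LinearMap.ker g ≤ LinearMap.range f := by
    intro z hz
    obtain ⟨z, rfl⟩ := Submodule.Quotient.mk_surjective _ z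
    have hz' : z ∈ B ⊔ Ideal.span {y} := by
      rw [LinearMap.mem_ker] at hz
      exact (Submodule.Quotient.mk_eq_zero _).1 hz
    obtain ⟨b, hb, c, hc, rfl⟩ := Submodule.mem_sup.1 hz'
    obtain ⟨c, rfl⟩ := Ideal.mem_span_singleton'.1 hc
    refine ⟨Submodule.Quotient.mk c, ?_⟩
    change Submodule.Quotient.mk (y * c) = _
    rw [Submodule.Quotient.eq]
    have : y * c - (b + c * y) = -b := by ring
    rw [this]; exact neg_mem hb
  calc Module.length R (LinearMap.ker g) ≤ Module.length R (LinearMap.range f) :=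
        Module.length_le_of_injective (Submodule.inclusion hf) (Submodule.inclusion_injective hf)
    _ ≤ _ := Module.length_le_of_surjective f.rangeRestrict f.surjective_rangeRestrict

lemma length_pow_bound {R : Type*} [CommRing R] : ∀ (n t : ℕ) (y : Fin n → R) (K : Ideal R),
    Module.length R (R ⧸ (K ⊔ Ideal.span (Set.range y) ^ (t + 1))) ≤
      ((n + t).choose n : ℕ) * Module.length R (R ⧸ (K ⊔ Ideal.span (Set.range y)))
  | 0, t, y, K => by
    have h0 : Ideal.span (Set.range y) = ⊥ := by
      rw [Set.range_eq_empty, Ideal.span_empty]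
    have h1 : K ⊔ Ideal.span (Set.range y) ≤ K ⊔ Ideal.span (Set.range y) ^ (t + 1) := by
      rw [h0, sup_bot_eq]; exact le_sup_left
    simpa using length_quot_mono h1
  | n + 1, 0, y, K => by
    have h1 : K ⊔ Ideal.span (Set.range y) ≤ K ⊔ Ideal.span (Set.range y) ^ (0 + 1) := by
      rw [zero_add, pow_one]
    simpa using length_quot_mono h1
  | n + 1, t + 1, y, K => by
    set I := Ideal.span (Set.range y) with hI
    set I' := Ideal.span (Set.range (Fin.tail y)) with hI'
    have hII : I = Ideal.span {y 0} ⊔ I' := by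
      rw [hI, hI', ← Ideal.span_union]
      congr 1
      conv_lhs => rw [← Fin.cons_self_tail y, Fin.range_cons]
      rfl
    have h1 := length_quot_step (A := K ⊔ I ^ (t + 1)) (B := K ⊔ I ^ (t + 1 + 1)) (y 0) (by
      intro a ha
      obtain ⟨k, hk, c, hc, rfl⟩ := Submodule.mem_sup.1 ha
      rw [mul_add]
      refine Submodule.add_mem_sup (Ideal.mul_mem_left _ _ hk) ?_
      rw [pow_succ' I (t + 1)]
      exact Ideal.mul_mem_mul (Ideal.subset_span ⟨0, rfl⟩) hc)
    have h2 : Module.length R (R ⧸ (K ⊔ I ^ (t + 1 + 1) ⊔ Ideal.span {y 0})) ≤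
        Module.length R (R ⧸ ((K ⊔ Ideal.span {y 0}) ⊔ I' ^ (t + 1 + 1))) := by
      apply length_quot_mono
      have : I' ^ (t + 1 + 1) ≤ I ^ (t + 1 + 1) := Ideal.pow_right_mono (hII ▸ le_sup_right) _
      refine sup_le (sup_le ?_ le_sup_right) ?_
      · exact le_sup_left.trans le_sup_left
      · exact this.trans (le_sup_right.trans le_sup_left)
    have h3 := length_pow_bound n (t + 1) (Fin.tail y) (K ⊔ Ideal.span {y 0})
    rw [← hI', sup_assoc K _ I', ← hII] at h3
    have h4 := length_pow_bound (n + 1) t y K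
    rw [← hI] at h4
    refine h1.trans ((add_le_add h4 (h2.trans h3)).trans ?_)
    rw [← add_mul, show n + 1 + (t + 1) = (n + 1 + t) + 1 by ring, Nat.choose_succ_succ,
      show n + (t + 1) = n + 1 + t by ring]
    push_cast
    rw [add_comm]

lemma indep {R : Type*} [CommRing R] [IsNoetherianRing R] [IsLocalRing R]
    (d : ℕ) (hd : ringKrullDim R = d)
    (x : Fin d → R) (hx : ∀ i, x i ∈ maximalIdeal R)
    (hred : ∃ m : ℕ, (maximalIdeal R) ^ (m + 1) =
      Ideal.span (Set.range x) * (maximalIdeal R) ^ m) :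
    LinearIndependent (ResidueField R)
      (fun i => ((maximalIdeal R).toCotangent ⟨x i, hx i⟩ : CotangentSpace R)) := by
  classical
  obtain ⟨k, hk⟩ := hred
  by_contra hcon
  obtain ⟨g, hg, i, hi⟩ := Fintype.not_linearIndependent_iff.1 hcon
  choose a ha using fun j => residue_surjective (g j)
  have hsum : ∑ j, a j * x j ∈ maximalIdeal R ^ 2 := by
    have h0 : (maximalIdeal R).toCotangent (∑ j, a j • ⟨x j, hx j⟩) = 0 := by
      rw [map_sum, ← hg]
      refine Finset.sum_congr rfl fun j _ => ?_
      rw [map_smul, ← ha j]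
      rfl
    rw [Ideal.toCotangent_eq_zero] at h0
    simpa using h0
  have hu : IsUnit (a i) := by
    rw [← residue_ne_zero_iff_isUnit, ha]; exact hi
  set J' : Ideal R := Ideal.span ((Finset.univ.erase i).image x : Finset R) with hJ'
  have hmem : ∀ j, j ≠ i → x j ∈ J' := fun j hj =>
    Ideal.subset_span (by simpa using ⟨j, hj, rfl⟩)
  have hxi : x i ∈ J' ⊔ maximalIdeal R ^ 2 := by
    rw [← Ideal.unit_mul_mem_iff_mem _ hu]
    rw [← Finset.add_sum_erase _ _ (Finset.mem_univ i)] at hsum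
    have : a i * x i = -(∑ j ∈ Finset.univ.erase i, a j * x j) +
      (a i * x i + ∑ j ∈ Finset.univ.erase i, a j * x j) := by ring
    rw [this]
    refine Submodule.add_mem_sup (neg_mem (Ideal.sum_mem _ fun j hj => ?_)) hsum
    exact Ideal.mul_mem_left _ _ (hmem j (Finset.ne_of_mem_erase hj))
  have hJ : Ideal.span (Set.range x) ≤ J' ⊔ maximalIdeal R ^ 2 := by
    rw [Ideal.span_le]
    rintro _ ⟨j, rfl⟩
    by_cases hj : j = i
    · subst hj; exact hxi
    · exact Ideal.mem_sup_left (hmem j hj)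
  have hJm : J' ≤ maximalIdeal R := by
    rw [hJ', Ideal.span_le]
    intro z hz
    simp only [Finset.coe_image, Set.mem_image] at hz
    obtain ⟨j, -, rfl⟩ := hz
    exact hx j
  have hnak : maximalIdeal R ^ (k + 1) ≤ J' * maximalIdeal R ^ k := by
    apply Submodule.le_of_le_smul_of_le_jacobson_bot (I := maximalIdeal R)
      (IsNoetherian.noetherian _) (maximalIdeal_le_jacobson _)
    rw [smul_eq_mul]
    calc maximalIdeal R ^ (k + 1) = Ideal.span (Set.range x) * maximalIdeal R ^ k := hk
      _ ≤ (J' ⊔ maximalIdeal R ^ 2) * maximalIdeal R ^ k := Ideal.mul_mono_left hJ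
      _ = J' * maximalIdeal R ^ k ⊔ maximalIdeal R * maximalIdeal R ^ (k + 1) := by
        rw [Ideal.sup_mul]; congr 1; ring
  have hmin : maximalIdeal R ∈ J'.minimalPrimes := by
    refine ⟨⟨inferInstance, hJm⟩, ?_⟩
    rintro q ⟨hq, hJq⟩ -
    exact hq.le_of_pow_le (hnak.trans (Ideal.mul_le_left.trans hJq))
  have hht := Ideal.height_le_card_of_mem_minimalPrimes_span_finset hmin
  have hdim := IsLocalRing.maximalIdeal_height_eq_ringKrullDim (R := R)
  rw [hd] at hdim
  have hdim' : (maximalIdeal R).height = d := by exact_mod_cast hdim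
  rw [hdim'] at hht
  have hcard : ((Finset.univ.erase i).image x).card ≤ d - 1 := by
    refine Finset.card_image_le.trans ?_
    simp
  have : d ≤ d - 1 := le_trans (by exact_mod_cast hht) hcard
  have := i.pos
  omega

lemma length_J {R : Type*} [CommRing R] [IsNoetherianRing R] [IsLocalRing R]
    (d : ℕ) (hd : ringKrullDim R = d)
    (e : ℕ) (he : e = Module.finrank (ResidueField R) (CotangentSpace R))
    (x : Fin d → R) (hx : ∀ i, x i ∈ maximalIdeal R)
    (hred : ∃ m : ℕ, (maximalIdeal R) ^ (m + 1) =
      Ideal.span (Set.range x) * (maximalIdeal R) ^ m)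
    (hBS : (maximalIdeal R) ^ (d + 1) ≤ Ideal.span (Set.range x)) :
    Module.length R (R ⧸ Ideal.span (Set.range x)) ≤ (e.choose d : ℕ) := by
  have hli := indep d hd x hx hred
  set v : Fin d → CotangentSpace R :=
    fun i => ((maximalIdeal R).toCotangent ⟨x i, hx i⟩ : CotangentSpace R) with hv
  set W := Submodule.span (ResidueField R) (Set.range v) with hW
  have hWd : Module.finrank (ResidueField R) W = d := by
    rw [hW, finrank_span_eq_card hli, Fintype.card_fin]
  obtain ⟨C, hC⟩ := Submodule.exists_isCompl W
  have hCd : d + Module.finrank (ResidueField R) C = e := by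
    rw [he, ← Submodule.finrank_add_eq_of_isCompl hC, hWd]
  set n := Module.finrank (ResidueField R) C with hn
  let b := Module.finBasis (ResidueField R) C
  choose y hy using fun j => (maximalIdeal R).toCotangent_surjective (b j : CotangentSpace R)
  have hspan : Submodule.span (ResidueField R) ((maximalIdeal R).toCotangent ''
      (Set.range (fun i => (⟨x i, hx i⟩ : maximalIdeal R)) ∪ Set.range y)) = ⊤ := by
    rw [Set.image_union, Submodule.span_union, ← Set.range_comp, ← Set.range_comp,
      ← hC.sup_eq_top]
    congr 1
    have : (⇑(maximalIdeal R).toCotangent ∘ y) = C.subtype ∘ b := funext hy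
    rw [this, Set.range_comp, Submodule.span_image, b.span_eq, Submodule.map_top,
      Submodule.range_subtype]
  rw [CotangentSpace.span_image_eq_top_iff] at hspan
  set I := Ideal.span (Set.range fun j => (y j : R)) with hI
  have hmax : Ideal.span (Set.range x) ⊔ I = maximalIdeal R := by
    have := congrArg (Submodule.map (maximalIdeal R).subtype) hspan
    rw [Submodule.map_top, Submodule.range_subtype, Submodule.map_span, Set.image_union,
      ← Set.range_comp, ← Set.range_comp, Submodule.span_union] at this
    exact this
  have hb := length_pow_bound n d (fun j => (y j : R)) (Ideal.span (Set.range x))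
  rw [← hI, hmax] at hb
  have hIle : I ^ (d + 1) ≤ Ideal.span (Set.range x) :=
    (Ideal.pow_right_mono (hmax ▸ le_sup_right) _).trans hBS
  rw [sup_eq_left.2 hIle] at hb
  have h1 : Module.length R (R ⧸ maximalIdeal R) = 1 := by
    rw [Module.length_eq_one_iff, isSimpleModule_iff_isCoatom]
    exact (maximalIdeal.isMaximal R).out
  rw [h1, mul_one, add_comm n d, hCd, ← hCd, Nat.choose_symm_add.symm] at hb
  rw [← hCd]
  exact hb

/-- Let `(R, m)` be a Noetherian local ring of dimension `d` with infinite residue field and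
embedding dimension `e`, and suppose `m ^ (d + 1) ⊆ J` for a minimal reduction `J = (x 1, …, x d)`
of `m`.  Then the Hilbert–Samuel multiplicity
`e(R) = lim_s d! ⬝ length(R ⧸ m ^ s) / s ^ d` satisfies `e(R) ≤ e.choose d`. -/
theorem stmt12 {R : Type*} [CommRing R] [IsNoetherianRing R] [IsLocalRing R]
    [Infinite (ResidueField R)]
    (d : ℕ) (hd : ringKrullDim R = d)
    (e : ℕ) (he : e = Module.finrank (ResidueField R) (CotangentSpace R))
    (x : Fin d → R) (hx : ∀ i, x i ∈ maximalIdeal R)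
    (hred : ∃ m : ℕ, (maximalIdeal R) ^ (m + 1) =
      Ideal.span (Set.range x) * (maximalIdeal R) ^ m)
    (hBS : (maximalIdeal R) ^ (d + 1) ≤ Ideal.span (Set.range x))
    (len : ℕ → ℕ)
    (hlen : ∀ s : ℕ, (len s : WithBot ℕ∞) = moduleLength R (R ⧸ (maximalIdeal R) ^ s))
    (eR : ℝ)
    (hmult : Tendsto (fun s : ℕ => ((Nat.factorial d : ℝ) * len s) / (s : ℝ) ^ d)
      atTop (nhds eR)) :
    eR ≤ e.choose d := by
  have hL := length_J d hd e he x hx hred hBS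
  have hxm : Ideal.span (Set.range x) ≤ maximalIdeal R := by
    rw [Ideal.span_le]; rintro _ ⟨i, rfl⟩; exact hx i
  have hlenle : ∀ t : ℕ, len (t + 1) ≤ (d + t).choose d * e.choose d := by
    intro t
    have h1 := length_pow_bound d t x ⊥
    rw [bot_sup_eq, bot_sup_eq] at h1
    have h2 : Module.length R (R ⧸ maximalIdeal R ^ (t + 1)) ≤
        ((d + t).choose d : ℕ) * (e.choose d : ℕ) :=
      (length_quot_mono (Ideal.pow_right_mono hxm _)).trans
        (h1.trans (mul_le_mul_right hL _))
    have h3 : ((len (t + 1) : ℕ) : ℕ∞) = Module.length R (R ⧸ maximalIdeal R ^ (t + 1)) := by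
      apply WithBot.coe_injective
      rw [Module.coe_length]
      exact hlen (t + 1)
    rw [← h3] at h2
    exact_mod_cast h2
  have hfact : ∀ t : ℕ, d.factorial * len (t + 1) ≤ (t + d) ^ d * e.choose d := by
    intro t
    calc d.factorial * len (t + 1) ≤ d.factorial * ((d + t).choose d * e.choose d) :=
          Nat.mul_le_mul_left _ (hlenle t)
      _ = (t + 1).ascFactorial d * e.choose d := by
          rw [Nat.ascFactorial_eq_factorial_mul_choose, add_comm t d, mul_assoc]
      _ ≤ _ := Nat.mul_le_mul_right _ (Nat.ascFactorial_le_pow_add t d)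
  have hlim : Tendsto (fun t : ℕ => (((t : ℝ) + d) / ((t : ℝ) + 1)) ^ d * (e.choose d : ℝ))
      atTop (nhds (e.choose d : ℝ)) := by
    have h1 : Tendsto (fun t : ℕ => ((t : ℝ) + d) / ((t : ℝ) + 1)) atTop (nhds 1) := by
      have h2 : Tendsto (fun t : ℕ => 1 + ((d : ℝ) - 1) * (1 / ((t : ℝ) + 1))) atTop
          (nhds (1 + ((d : ℝ) - 1) * 0)) :=
        tendsto_const_nhds.add (tendsto_const_nhds.mul tendsto_one_div_add_atTop_nhds_zero_nat)
      rw [mul_zero, add_zero] at h2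
      refine h2.congr fun t => ?_
      have : (t : ℝ) + 1 ≠ 0 := by positivity
      field_simp
      ring
    simpa using (h1.pow d).mul_const (e.choose d : ℝ)
  refine le_of_tendsto_of_tendsto' ((tendsto_add_atTop_iff_nat 1).2 hmult) hlim fun t => ?_
  have h1 : (d.factorial : ℝ) * len (t + 1) ≤ ((t : ℝ) + d) ^ d * (e.choose d : ℝ) := by
    exact_mod_cast hfact t
  rw [div_pow, div_mul_eq_mul_div]
  push_cast
  gcongr
end
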